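/- arXiv:1901.10043 — 2 statements merged into one kernel-verified Lean document; each statement's English description precedes it below -/
import Mathlib

section
/- Let (R, 𝔪) be a regular local ring of Krull dimension 2 with field of fractions F, and let (R_i, 𝔪_i)_{i∈ℕ} be a simple sequence of local quadratic transforms of R. Then there exists exactly one valuation subring V of F such that V dominates R_i for every i ∈ ℕ (that is, R_i ⊆ V and 𝔪_i = R_i ∩ 𝔪_V, where 𝔪_V is the maximal ideal of V). -/
open IsLocalRing

variable {F : Type*} [Field F]

/-- The set of nonunits of a subring `S` of `F`; when `S` is a local ring this is
(the image in `F` of) its maximal ideal `𝔪_S`. -/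
def mSet (S : Subring F) : Set F :=
  {f : F | ∃ h : f ∈ S, ¬ IsUnit (⟨f, h⟩ : S)}

/-- Membership in `𝔪_S ^ 2`: finite sums of products of two nonunits of `S`. -/
def sqSet (S : Subring F) : Set F :=
  {f : F | ∃ (n : ℕ) (a b : Fin n → F),
    (∀ i, a i ∈ mSet S ∧ b i ∈ mSet S) ∧ f = ∑ i, a i * b i}

/-- The subring of `F` generated by `S` together with the elements `a / x`
for `a` in the maximal ideal of `S`. -/
def quadT (S : Subring F) (x : F) : Subring F :=
  Subring.closure ((S : Set F) ∪ {f : F | ∃ a ∈ mSet S, f = a / x})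

/-- `T'` is a local quadratic transform of `S`: `T' = T_𝔭` where `x ∈ 𝔪_S \ 𝔪_S²`,
`T` is the subring of `F` generated by `S` and the `a/x` (`a ∈ 𝔪_S`), and `𝔭` is a
prime ideal of `T` with `𝔭 ∩ S = 𝔪_S`. -/
def IsLQT (S T' : Subring F) : Prop :=
  ∃ x ∈ mSet S, x ∉ sqSet S ∧
    ∃ 𝔭 : Ideal (quadT S x), 𝔭.IsPrime ∧
      (∀ (f : F) (hfS : f ∈ S) (hfT : f ∈ quadT S x),
        ((⟨f, hfT⟩ : quadT S x) ∈ 𝔭 ↔ f ∈ mSet S)) ∧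
      (T' : Set F) = {f : F | ∃ t s : quadT S x, s ∉ 𝔭 ∧ f = (t : F) / (s : F)}

/-- `S` is a regular local ring of Krull dimension 2: a Noetherian local ring of Krull
dimension 2 whose set of nonunits (= maximal ideal) is generated by two elements. -/
def IsRegLocal2 (S : Subring F) : Prop :=
  IsNoetherianRing S ∧ IsLocalRing S ∧ ringKrullDim S = 2 ∧
    ∃ x y : S, ((Ideal.span {x, y} : Ideal S) : Set S) = {f : S | ¬ IsUnit f}

/-- `F` is the field of fractions of the subring `S`. -/
def IsFracField (S : Subring F) : Prop :=
  ∀ f : F, ∃ a ∈ S, ∃ b ∈ S, b ≠ 0 ∧ f = a / b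

/-- `(Rs i)_{i ∈ ℕ}` is a simple sequence of local quadratic transforms of `R₀`:
`Rs 0 = R₀` and each `Rs (i+1)` is a local quadratic transform of `Rs i` which is
again a regular local ring of Krull dimension 2 with field of fractions `F`. -/
def IsSimpleSeq (R₀ : Subring F) (Rs : ℕ → Subring F) : Prop :=
  Rs 0 = R₀ ∧ ∀ i : ℕ,
    IsLQT (Rs i) (Rs (i + 1)) ∧ IsRegLocal2 (Rs (i + 1)) ∧ IsFracField (Rs (i + 1))

/-- A subring `A` of `F` dominates a subring `S` of `F` if `S ⊆ A` and
`𝔪_S = S ∩ 𝔪_A` (on nonunit sets). -/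
def Dominates (S A : Subring F) : Prop :=
  (S : Set F) ⊆ (A : Set F) ∧ ∀ f ∈ (S : Set F), (f ∈ mSet S ↔ f ∈ mSet A)

open IsLocalRing in
theorem aux_principal {R : Type*} [CommRing R] [IsDomain R] [IsNoetherianRing R] [IsLocalRing R]
    (x y : R) (hm : maximalIdeal R = Ideal.span {x, y}) (P : Ideal R) (hP : P.IsPrime)
    (hx : x ∉ P) : ∃ p, P = Ideal.span {p} := by
  have hxm : x ∈ maximalIdeal R := hm ▸ Ideal.subset_span (by simp)
  have hym : y ∈ maximalIdeal R := hm ▸ Ideal.subset_span (by simp)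
  have hne : Ideal.span {x} ≠ ⊤ := by
    rw [Ne, Ideal.span_singleton_eq_top]; exact hxm
  have : Nontrivial (R ⧸ Ideal.span {x}) := Ideal.Quotient.nontrivial_iff.mpr hne
  have : IsLocalRing (R ⧸ Ideal.span {x}) :=
    IsLocalRing.of_surjective' (Ideal.Quotient.mk (Ideal.span {x})) Ideal.Quotient.mk_surjective
  set π := Ideal.Quotient.mk (Ideal.span {x}) with hπ
  have hmax : maximalIdeal (R ⧸ Ideal.span {x}) = Ideal.span {π y} := by
    have h1 : maximalIdeal (R ⧸ Ideal.span {x}) = (maximalIdeal R).map π := by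
      symm
      have : IsLocalHom π := IsLocalHom.of_surjective π Ideal.Quotient.mk_surjective
      have h2 := IsLocalRing.maximalIdeal_comap π
      rw [← h2, Ideal.map_comap_of_surjective π Ideal.Quotient.mk_surjective]
    rw [h1, hm, Ideal.map_span, Set.image_pair]
    have : π x = 0 := Ideal.Quotient.eq_zero_iff_mem.mpr (Ideal.mem_span_singleton_self x)
    rw [this, Ideal.span_insert_zero]
  have hPIR : IsPrincipalIdealRing (R ⧸ Ideal.span {x}) := by
    apply IsPrincipalIdealRing.of_prime
    intro Q hQ
    by_cases hy : π y ∈ Q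
    · have : Q = maximalIdeal _ := by
        apply le_antisymm (le_maximalIdeal hQ.ne_top)
        rw [hmax, Ideal.span_singleton_le_iff_mem]; exact hy
      exact ⟨π y, by rw [this, hmax]⟩
    · have : Q ≤ ⊥ := by
        apply Submodule.le_of_le_smul_of_le_jacobson_bot (I := maximalIdeal _)
          (IsNoetherian.noetherian Q) (maximalIdeal_le_jacobson _)
        intro q hq
        apply Submodule.mem_sup_right
        have hq' := le_maximalIdeal hQ.ne_top hq
        rw [hmax, Ideal.mem_span_singleton] at hq'
        obtain ⟨s, rfl⟩ := hq'
        exact Submodule.smul_mem_smul (hmax ▸ Ideal.mem_span_singleton_self _)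
          ((hQ.mem_or_mem hq).resolve_left hy)
      rw [le_bot_iff.mp this]
      infer_instance
  obtain ⟨pb, hpb⟩ := (hPIR.principal (P.map π)).principal
  have hpb' : P.map π = Ideal.span {pb} := hpb
  have : pb ∈ P.map π := hpb' ▸ Ideal.mem_span_singleton_self _
  obtain ⟨p, hp, rfl⟩ := (Ideal.mem_map_iff_of_surjective π Ideal.Quotient.mk_surjective).mp this
  refine ⟨p, le_antisymm ?_ ((Ideal.span_singleton_le_iff_mem P).mpr hp)⟩
  apply Submodule.le_of_le_smul_of_le_jacobson_bot (I := maximalIdeal _)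
          (IsNoetherian.noetherian P) (maximalIdeal_le_jacobson _)
  intro q hq
  have h1 : π q ∈ P.map π := Ideal.mem_map_of_mem _ hq
  rw [hpb', Ideal.mem_span_singleton] at h1
  obtain ⟨rb, hrb⟩ := h1
  obtain ⟨r, rfl⟩ := Ideal.Quotient.mk_surjective rb
  have h2 : q - p * r ∈ Ideal.span {x} := by
    rw [← Ideal.Quotient.eq_zero_iff_mem, map_sub, map_mul]
    exact sub_eq_zero.mpr hrb
  obtain ⟨s, hs⟩ := Ideal.mem_span_singleton.mp h2
  have hxs : x * s ∈ P := hs ▸ P.sub_mem hq (P.mul_mem_right _ hp)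
  have hsP := (hP.mem_or_mem hxs).resolve_left hx
  have : q = p * r + x • s := by rw [smul_eq_mul, ← hs]; ring
  rw [this]
  exact Submodule.add_mem_sup (Ideal.mul_mem_right _ _ (Ideal.mem_span_singleton_self _))
    (Submodule.smul_mem_smul hxm hsP)

open IsLocalRing in
theorem aux_ufd {R : Type*} [CommRing R] [IsDomain R] [IsNoetherianRing R] [IsLocalRing R]
    (hdim : ringKrullDim R = 2)
    (x y : R) (hm : maximalIdeal R = Ideal.span {x, y}) : UniqueFactorizationMonoid R := by
  have key : ∀ P : Ideal R, P.IsPrime → P ≠ ⊥ → P ≠ maximalIdeal R → ∃ p ∈ P, Prime p := by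
    intro P hP h0 hmx
    have : ∃ p, P = Ideal.span {p} := by
      by_cases hx : x ∈ P
      · by_cases hy : y ∈ P
        · exfalso
          apply hmx
          apply le_antisymm (le_maximalIdeal hP.ne_top)
          rw [hm, Ideal.span_le]
          rintro t (rfl | rfl) <;> assumption
        · exact aux_principal y x (by rw [hm, Set.pair_comm]) P hP hy
      · exact aux_principal x y hm P hP hx
    obtain ⟨p, rfl⟩ := this
    refine ⟨p, Ideal.mem_span_singleton_self p, ?_⟩
    rwa [← Ideal.span_singleton_prime]
    rintro rfl
    simp at h0
  rw [UniqueFactorizationMonoid.iff_exists_prime_mem_of_isPrime]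
  intro I hI hIp
  by_cases h : I = maximalIdeal R
  · have : ∃ P : Ideal R, P.IsPrime ∧ P ≠ ⊥ ∧ P ≠ maximalIdeal R := by
      by_contra! hc
      have : Ring.KrullDimLE 1 R := by
        rw [Ring.krullDimLE_one_iff_of_isPrime_bot]
        intro J hJ hJp
        rw [hc J hJp hJ]; infer_instance
      rw [Ring.krullDimLE_iff, hdim] at this
      exact absurd this (by decide)
    obtain ⟨P, hP, h0, h1⟩ := this
    obtain ⟨p, hp, hpp⟩ := key P hP h0 h1
    exact ⟨p, h ▸ le_maximalIdeal hP.ne_top hp, hpp⟩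
  · exact key I hIp hI h

theorem aux_denom {F : Type*} [Field F] (A : Subring F)
    (hfrac : ∀ f : F, ∃ d ∈ A, d ≠ 0 ∧ d * f ∈ A) (c : ℕ → F) (n : ℕ) :
    ∃ d ∈ A, d ≠ 0 ∧ ∀ j ≤ n, d * c j ∈ A := by
  induction n with
  | zero =>
    obtain ⟨d, h, h1, h2⟩ := hfrac (c 0)
    refine ⟨d, h, h1, fun j hj => ?_⟩
    obtain rfl : j = 0 := by omega
    exact h2
  | succ n ih =>
    obtain ⟨d, h, h1, h2⟩ := hfrac (c (n+1))
    obtain ⟨e, g, g1, g2⟩ := ih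
    refine ⟨d * e, A.mul_mem h g, mul_ne_zero h1 g1, fun j hj => ?_⟩
    rcases Nat.lt_or_ge n j with h3 | h3
    · obtain rfl : j = n + 1 := by omega
      rw [mul_right_comm]; exact A.mul_mem h2 g
    · rw [mul_assoc]; exact A.mul_mem h (g2 j h3)

def auxN {F : Type*} [Field F] (A D : Subring F) (hAD : A ≤ D) (e : F) : Ideal A where
  carrier := {r | ∃ t ∈ D, (r : F) = e * t}
  zero_mem' := ⟨0, D.zero_mem, by simp⟩
  add_mem' := by
    rintro r s ⟨t, ht, h⟩ ⟨u, hu, h'⟩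
    exact ⟨t + u, D.add_mem ht hu, by push_cast; rw [h, h']; ring⟩
  smul_mem' := by
    rintro r s ⟨t, ht, h⟩
    exact ⟨r * t, D.mul_mem (hAD r.2) ht, by simp [h]; ring⟩

open scoped Pointwise in
theorem aux_chain {F : Type*} [Field F] (A : Subring F) [IsNoetherianRing A] [Ring.KrullDimLE 1 A]
    (hfrac : ∀ f : F, ∃ d ∈ A, d ≠ 0 ∧ d * f ∈ A) (D : Subring F) (hAD : A ≤ D)
    (a : A) (ha : a ≠ 0) (n : ℕ) (c x : ℕ → F) (hc0 : c 0 = 1) (hcne : ∀ j ≤ n, c j ≠ 0)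
    (hcs : ∀ j < n, c (j + 1) = c j * x j)
    (hx : ∀ j < n, x j ∈ D) (hx' : ∀ j < n, (x j)⁻¹ ∉ D)
    (hac : (a : F) / c n ∈ D) : (n : ℕ∞) ≤ Ring.ord A a := by
  obtain ⟨d, hdA, hd0, hd⟩ := aux_denom A hfrac c n
  set N : ℕ → Ideal A := fun j => auxN A D hAD (d * c j) with hN
  have hlt : ∀ j < n, N (j + 1) < N j := by
    intro j hj
    refine lt_of_le_of_ne ?_ ?_
    · rintro r ⟨t, ht, h⟩
      exact ⟨x j * t, D.mul_mem (hx j hj) ht, by rw [h, hcs j hj]; ring⟩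
    · intro h
      have h1 : (⟨d * c j, hd j hj.le⟩ : A) ∈ N j := ⟨1, D.one_mem, by simp⟩
      rw [← h] at h1
      obtain ⟨t, ht, h2⟩ := h1
      apply hx' j hj
      have h3 : d * c j * 1 = d * c j * (x j * t) := by
        simp only [hcs j hj] at h2; rw [mul_one]; refine h2.trans ?_; ring
      have h4 := mul_left_cancel₀ (mul_ne_zero hd0 (hcne j hj.le)) h3
      rwa [← eq_inv_of_mul_eq_one_right h4.symm]
  have hlen : ∀ j ≤ n, Module.length A (A ⧸ N 0) + j ≤ Module.length A (A ⧸ N j) := by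
    intro j hj
    induction j with
    | zero => simp
    | succ j ih =>
      have h1 := ih (by omega)
      have h2 := Order.coheight_add_one_le (hlt j (by omega))
      rw [← Module.length_quotient, ← Module.length_quotient] at h2
      refine le_trans ?_ h2
      push_cast
      rw [← add_assoc]
      gcongr
  have hle : a • N 0 ≤ N n := by
    intro r hr
    obtain ⟨s, ⟨t, ht, h⟩, rfl⟩ := hr
    refine ⟨(a : F) / c n * t, D.mul_mem hac ht, ?_⟩
    have := hcne n le_rfl
    change (a : F) * s = _
    rw [h, hc0]
    field_simp
  have h1 : Module.length A (A ⧸ N n) ≤ Module.length A (A ⧸ (a • N 0)) :=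
    Module.length_le_of_surjective (Submodule.factor hle) (Submodule.factor_surjective hle)
  have h2 := Module.length_eq_add_of_exact (Ideal.mulQuot a (N 0))
          (Ideal.quotOfMul a (N 0)) (Ideal.mulQuot_injective _ (mem_nonZeroDivisors_of_ne_zero ha))
          (Ideal.quotOfMul_surjective _) (Ideal.exact_mulQuot_quotOfMul _)
  have h3 := (hlen n le_rfl).trans (h1.trans h2.le)
  have h4 : Module.length A (A ⧸ N 0) ≠ ⊤ := by
    have hdd : (⟨d, hdA⟩ : A) ∈ N 0 := ⟨1, D.one_mem, by simp [hc0]⟩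
    have hle : Ideal.span {(⟨d, hdA⟩ : A)} ≤ N 0 := (Ideal.span_singleton_le_iff_mem _).mpr hdd
    have h5 : Ring.ord A (⟨d, hdA⟩ : A) ≠ ⊤ := Ring.ord_ne_top (mem_nonZeroDivisors_of_ne_zero
      (fun h => hd0 (congrArg Subtype.val h)))
    exact ne_top_of_le_ne_top h5
      (Module.length_le_of_surjective (Submodule.factor hle) (Submodule.factor_surjective hle))
  exact (ENat.add_le_add_iff_left h4).mp h3

open IsLocalRing Polynomial in
theorem aux_D' {F : Type*} [Field F] (S : Subring F) (hS : IsLocalRing S) (z : F)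
    (P : Ideal S[X]) (hP : P = (maximalIdeal S).map C) [hPp : P.IsPrime]
    (L : Type*) [CommRing L] [Algebra S[X] L] [IsLocalization.AtPrime L P]
    (H : ∀ g : S[X], eval₂ S.subtype z g = 0 → ∀ i, ¬ IsUnit (g.coeff i)) :
    ∃ D : Subring F, (∀ f, f ∈ D ↔ ∃ p q : S[X], (∃ i, IsUnit (q.coeff i)) ∧
        f = eval₂ S.subtype z p / eval₂ S.subtype z q) ∧
      (IsNoetherianRing S → (∃ x y : S, maximalIdeal S = Ideal.span {x, y}) →
        (∃ g : S[X], g ≠ 0 ∧ eval₂ S.subtype z g = 0) →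
        IsNoetherianRing D ∧ Ring.KrullDimLE 1 D) := by
  have hmem : ∀ q : S[X], q ∉ P ↔ ∃ i, IsUnit (q.coeff i) := by
    intro q
    rw [hP, Ideal.mem_map_C_iff]
    simp [mem_maximalIdeal]
  set φ : S[X] →+* F := eval₂RingHom S.subtype z with hφ
  have hu : ∀ q : P.primeCompl, IsUnit (φ q) := by
    rintro ⟨q, hq⟩
    obtain ⟨i, hi⟩ := (hmem q).mp hq
    rw [isUnit_iff_ne_zero]
    intro h0
    exact H q h0 i hi
  let ψ : L →+* F := IsLocalization.lift (M := P.primeCompl) hu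
  have hψ : ∀ p, ψ (algebraMap _ _ p) = φ p := fun p => IsLocalization.lift_eq hu p
  refine ⟨ψ.range, ?_, ?_⟩
  · intro f
    constructor
    · rintro ⟨w, rfl⟩
      obtain ⟨p, q, rfl⟩ := IsLocalization.exists_mk'_eq P.primeCompl w
      refine ⟨p, q, (hmem q).mp q.2, ?_⟩
      have hne : φ q ≠ 0 := (hu q).ne_zero
      change ψ _ = φ p / φ q
      rw [eq_div_iff hne, ← hψ, ← hψ, ← map_mul, IsLocalization.mk'_spec]
    · rintro ⟨p, q, hq, rfl⟩
      have hq' := (hmem q).mpr hq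
      refine ⟨IsLocalization.mk' _ p (⟨q, hq'⟩ : P.primeCompl), ?_⟩
      have hne : φ q ≠ 0 := (hu ⟨q, hq'⟩).ne_zero
      change ψ _ = φ p / φ q
      rw [eq_div_iff hne, ← hψ q, ← hψ, ← map_mul]
      exact congrArg ψ (IsLocalization.mk'_spec _ p (⟨q, hq'⟩ : P.primeCompl))
  · rintro hN ⟨x, y, hxy⟩ ⟨g, hg0, hg⟩
    have : IsNoetherianRing (L) :=
      IsLocalization.isNoetherianRing P.primeCompl _ inferInstance
    refine ⟨isNoetherianRing_range ψ, ?_⟩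
    have hht : P.height ≤ 2 := by
      have h1 : P = Ideal.span {C x, C y} := by
        rw [hP, hxy, Ideal.map_span, Set.image_pair]
      have h2 : ({C x, C y} : Set S[X]).Finite := by simp
      refine (Ideal.height_le_card_of_mem_minimalPrimes_span h2 (p := P) ?_).trans ?_
      · rw [← h1, Ideal.minimalPrimes_eq_subsingleton_self]; simp
      · exact_mod_cast Set.ncard_insert_le (C x) {C y} |>.trans (by simp)
    have hdim : ringKrullDim (L) ≤ 2 := by
      rw [IsLocalization.AtPrime.ringKrullDim_eq_height P]
      exact WithBot.coe_le_coe.mpr hht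
    have hdom : IsDomain (L) :=
      IsLocalization.isDomain_of_le_nonZeroDivisors _ P.primeCompl_le_nonZeroDivisors
    have h3 := ringKrullDim_succ_le_of_surjective ψ.rangeRestrict ψ.rangeRestrict_surjective
      (r := algebraMap _ _ g) (mem_nonZeroDivisors_of_ne_zero (by
        intro h
        rw [IsLocalization.to_map_eq_zero_iff _ P.primeCompl_le_nonZeroDivisors] at h
        exact hg0 h)) (by
        apply Subtype.ext
        change ψ _ = 0
        rw [hψ]; exact hg)
    rw [Ring.krullDimLE_iff]
    have h4 := h3.trans hdim
    have h5 : ringKrullDim ψ.range + 1 ≤ 1 + 1 := by rw [one_add_one_eq_two]; exact h4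
    exact_mod_cast (ENat.WithBot.add_le_add_one_right_iff).mp h5

open IsLocalRing Polynomial in
theorem aux_D {F : Type*} [Field F] (S : Subring F) (hS : IsLocalRing S) (z : F)
    (H : ∀ g : S[X], eval₂ S.subtype z g = 0 → ∀ i, ¬ IsUnit (g.coeff i)) :
    ∃ D : Subring F, (∀ f, f ∈ D ↔ ∃ p q : S[X], (∃ i, IsUnit (q.coeff i)) ∧
        f = eval₂ S.subtype z p / eval₂ S.subtype z q) ∧
      (IsNoetherianRing S → (∃ x y : S, maximalIdeal S = Ideal.span {x, y}) →
        (∃ g : S[X], g ≠ 0 ∧ eval₂ S.subtype z g = 0) →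
        IsNoetherianRing D ∧ Ring.KrullDimLE 1 D) := by
  have hPp : ((maximalIdeal S).map (C : S →+* S[X])).IsPrime :=
    (Ideal.isPrime_map_C_iff_isPrime _).mpr inferInstance
  exact aux_D' S hS z _ rfl (Localization.AtPrime ((maximalIdeal S).map (C : S →+* S[X]))) H

open IsLocalRing Polynomial in
/-- Over a local UFD `S`, if neither `z` nor `z⁻¹` is in `S`, then `z` is residually
transcendental. -/
theorem aux_trans {F : Type*} [Field F] (S : Subring F) (hS : IsLocalRing S)
    (hU : UniqueFactorizationMonoid S) (hfr : ∀ f : F, ∃ a ∈ S, ∃ b ∈ S, b ≠ 0 ∧ f = a / b)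
    (z : F) (hz : z ∉ S) (hz' : z⁻¹ ∉ S)
    (g : S[X]) (hg : eval₂ S.subtype z g = 0) (i : ℕ) : ¬ IsUnit (g.coeff i) := by
  have hfrac : IsFractionRing S F := by
    refine IsFractionRing.of_field S F ?_
    intro f
    obtain ⟨a, ha, b, hb, _, rfl⟩ := hfr f
    exact ⟨⟨a, ha⟩, ⟨b, hb⟩, rfl⟩
  let _ : NormalizedGCDMonoid S := Classical.choice inferInstance
  obtain ⟨a, b, hrel, hzab⟩ := IsFractionRing.exists_reduced_fraction (A := S) z
  have hb0 : (b : S) ≠ 0 := nonZeroDivisors.ne_zero b.2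
  have hb0F : ((b : S) : F) ≠ 0 := fun h => hb0 (Subtype.ext h)
  have hz1 : z = (a : F) / ((b : S) : F) := by
    rw [← hzab, IsFractionRing.mk'_eq_div]; rfl
  have unit_mem : ∀ u : S, IsUnit u → ((u : F)⁻¹) ∈ S := by
    intro u hu
    obtain ⟨v, hv⟩ := hu.exists_right_inv
    have : (u : F) * v = 1 := congrArg Subtype.val hv
    rw [inv_eq_of_mul_eq_one_right this]; exact v.2
  have hbn : ¬ IsUnit (b : S) := by
    intro hu
    apply hz; rw [hz1, div_eq_mul_inv]; exact S.mul_mem a.2 (unit_mem _ hu)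
  have han : ¬ IsUnit a := by
    intro hu
    apply hz'; rw [hz1, inv_div, div_eq_mul_inv]; exact S.mul_mem (b : S).2 (unit_mem _ hu)
  set l : S[X] := C (b : S) * X - C a with hl
  have hprim : l.IsPrimitive := by
    intro r hr
    have h0 : r ∣ a := by
      have := (C_dvd_iff_dvd_coeff r l).mp hr 0
      simpa [hl] using this
    have h1 : r ∣ (b : S) := by
      have := (C_dvd_iff_dvd_coeff r l).mp hr 1
      simpa [hl, coeff_C] using this
    exact hrel h0 h1
  have hdvd : l ∣ g := by
    rw [hprim.dvd_iff_fraction_map_dvd_fraction_map F]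
    have e1 : l.map (algebraMap S F) = C ((b : S) : F) * (X - C z) := by
      have : C ((b : S) : F) * C z = C (a : F) := by
        rw [← C_mul, hz1, mul_div_cancel₀ _ hb0F]
      rw [mul_sub, this]
      simp [hl]
      rfl
    rw [e1]
    refine (isUnit_C.mpr (isUnit_iff_ne_zero.mpr hb0F)).mul_left_dvd.mpr ?_
    rw [dvd_iff_isRoot, IsRoot, eval_map]
    exact hg
  obtain ⟨q, rfl⟩ := hdvd
  have hlm : l ∈ (maximalIdeal S).map (C : S →+* S[X]) := by
    apply Ideal.sub_mem
    · exact Ideal.mul_mem_right _ _ (Ideal.mem_map_of_mem _ hbn)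
    · exact Ideal.mem_map_of_mem _ han
  exact Ideal.mem_map_C_iff.mp (Ideal.mul_mem_right q _ hlm) i

theorem mSet_coe {F : Type*} [Field F] (S : Subring F) (a : S) :
    (a : F) ∈ mSet S ↔ ¬ IsUnit a :=
  ⟨fun ⟨_, h⟩ => h, fun h => ⟨a.2, h⟩⟩

theorem isUnit_iff_inv {F : Type*} [Field F] (S : Subring F) (a : F) (ha : a ∈ S) :
    IsUnit (⟨a, ha⟩ : S) ↔ a ≠ 0 ∧ a⁻¹ ∈ S := by
  constructor
  · intro h
    obtain ⟨v, hv⟩ := h.exists_right_inv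
    have h1 : a * v = 1 := congrArg Subtype.val hv
    refine ⟨left_ne_zero_of_mul_eq_one h1, ?_⟩
    rw [inv_eq_of_mul_eq_one_right h1]; exact v.2
  · rintro ⟨h0, h1⟩
    exact IsUnit.of_mul_eq_one (⟨a⁻¹, h1⟩ : S) (Subtype.ext (mul_inv_cancel₀ h0))

theorem mem_mSet {F : Type*} [Field F] (S : Subring F) (a : F) :
    a ∈ mSet S ↔ a ∈ S ∧ (a = 0 ∨ a⁻¹ ∉ S) := by
  constructor
  · rintro ⟨h, h1⟩
    rw [isUnit_iff_inv] at h1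
    refine ⟨h, ?_⟩
    by_contra! hc
    exact h1 hc
  · rintro ⟨h, h1⟩
    refine ⟨h, ?_⟩
    rw [isUnit_iff_inv]
    rintro ⟨h2, h3⟩
    exact h1.elim h2 (fun h => h h3)

theorem lqt_props {F : Type*} [Field F] (S T : Subring F) (h : IsLQT S T) :
    S ≤ T ∧ (∀ f ∈ mSet S, f ∈ mSet T) ∧
      ∃ x ∈ mSet S, x ≠ 0 ∧ ∀ a ∈ mSet S, a / x ∈ T := by
  obtain ⟨x, hx, hx2, 𝔭, hp, hcon, hT⟩ := h
  have hmemT : ∀ f, f ∈ T ↔ ∃ t s : quadT S x, s ∉ 𝔭 ∧ f = (t : F) / (s : F) := by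
    intro f
    rw [← SetLike.mem_coe, hT]; rfl
  have hQT : quadT S x ≤ T := by
    intro f hf
    rw [hmemT]
    exact ⟨⟨f, hf⟩, 1, fun h1 => hp.ne_top ((Ideal.eq_top_iff_one _).mpr h1), by simp⟩
  have hSQ : S ≤ quadT S x := fun f hf => Subring.subset_closure (Or.inl hf)
  refine ⟨hSQ.trans hQT, ?_, x, hx, ?_, ?_⟩
  · intro f hf
    have hfS : f ∈ S := ((mem_mSet S f).mp hf).1
    rw [mem_mSet]
    refine ⟨hQT (hSQ hfS), ?_⟩
    by_contra! hc
    obtain ⟨h0, hinv⟩ := hc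
    obtain ⟨t, s, hs, he⟩ := (hmemT _).mp hinv
    have hfp := (hcon f hfS (hSQ hfS)).mpr hf
    apply hs
    have hs0 : (s : F) ≠ 0 := by
      intro h
      rw [h, div_zero] at he
      exact inv_ne_zero h0 he
    have : s = t * ⟨f, hSQ hfS⟩ := by
      apply Subtype.ext
      change (s : F) = t * f
      field_simp at he
      rw [he]; ring
    rw [this]
    exact 𝔭.mul_mem_left _ hfp
  · rintro rfl
    exact hx2 ⟨0, fun _ => 0, fun _ => 0, fun i => i.elim0, by simp⟩
  · intro a ha
    exact hQT (Subring.subset_closure (Or.inr ⟨a, ha, rfl⟩))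

open IsLocalRing in
theorem reg_props {F : Type*} [Field F] (S : Subring F) (h : IsRegLocal2 S) :
    ∃ _ : IsLocalRing S, IsNoetherianRing S ∧ UniqueFactorizationMonoid S ∧
      ∃ x y : S, maximalIdeal S = Ideal.span {x, y} := by
  obtain ⟨hN, hL, hd, x, y, hxy⟩ := h
  have hm : maximalIdeal S = Ideal.span {x, y} := by
    apply SetLike.coe_injective
    rw [hxy]; rfl
  exact ⟨hL, hN, aux_ufd hd x y hm, x, y, hm⟩

open Polynomial in
theorem main_lemma {F : Type*} [Field F] (Rs : ℕ → Subring F)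
    (hreg : ∀ i, IsRegLocal2 (Rs i)) (hfr : ∀ i, IsFracField (Rs i))
    (hl : ∀ i, IsLQT (Rs i) (Rs (i + 1))) (z : F) : ∃ i, z ∈ Rs i ∨ z⁻¹ ∈ Rs i := by
  by_contra! hcon
  have hmono : Monotone Rs := monotone_nat_of_le_succ fun i => (lqt_props _ _ (hl i)).1
  have hmm : Monotone fun i => mSet (Rs i) :=
    monotone_nat_of_le_succ fun i => (lqt_props _ _ (hl i)).2.1
  choose x hxm hx0 hxd using fun i => (lqt_props _ _ (hl i)).2.2
  have hz0 : z ≠ 0 := by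
    rintro rfl
    exact (hcon 0).1 (Rs 0).zero_mem
  obtain ⟨a, ha, b, hb, hb0, hzab⟩ := hfr 0 z
  have ha0 : a ≠ 0 := by
    rintro rfl
    simp at hzab; exact hz0 hzab
  -- the partial products
  set c : ℕ → F := fun n => ∏ i ∈ Finset.range n, x i with hc
  have hcs : ∀ j, c (j + 1) = c j * x j := fun j => Finset.prod_range_succ _ _
  have hcne : ∀ j, c j ≠ 0 := fun j => Finset.prod_ne_zero_iff.mpr fun i _ => hx0 i
  have hdiv : ∀ n, a / c n ∈ Rs n ∧ b / c n ∈ Rs n := by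
    intro n
    induction n with
    | zero => simpa [hc] using ⟨ha, hb⟩
    | succ n ih =>
      obtain ⟨h1, h2⟩ := ih
      have hzn : z = (a / c n) / (b / c n) := by
        rw [div_div_div_cancel_right₀ (hcne n), hzab]
      have h3 : a / c n ∈ mSet (Rs n) := by
        rw [mem_mSet]
        refine ⟨h1, Or.inr fun h => (hcon n).2 ?_⟩
        rw [hzn, inv_div, div_eq_mul_inv]
        exact (Rs n).mul_mem h2 h
      have h4 : b / c n ∈ mSet (Rs n) := by
        rw [mem_mSet]
        refine ⟨h2, Or.inr fun h => (hcon n).1 ?_⟩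
        rw [hzn, div_eq_mul_inv]
        exact (Rs n).mul_mem h1 h
      rw [hcs, ← div_div, ← div_div]
      exact ⟨hxd n _ h3, hxd n _ h4⟩
  have hD : ∀ i, ∃ D : Subring F, (∀ f, f ∈ D ↔ ∃ p q : (Rs i)[X], (∃ i, IsUnit (q.coeff i)) ∧
        f = eval₂ (Rs i).subtype z p / eval₂ (Rs i).subtype z q) ∧
        ((∃ g : (Rs i)[X], g ≠ 0 ∧ eval₂ (Rs i).subtype z g = 0) →
        IsNoetherianRing D ∧ Ring.KrullDimLE 1 D) := by
    intro i
    obtain ⟨hL, hN, hU, hxy⟩ := reg_props _ (hreg i)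
    obtain ⟨D, h1, h2⟩ := aux_D (Rs i) hL z
      (aux_trans (Rs i) hL hU (hfr i) z (hcon i).1 (hcon i).2)
    exact ⟨D, h1, h2 hN hxy⟩
  choose D hDmem hDprop using hD
  have hRD : ∀ i, Rs i ≤ D i := by
    intro i f hf
    rw [hDmem]
    exact ⟨C ⟨f, hf⟩, 1, ⟨0, by simp⟩, by simp⟩
  have hDD : ∀ n, D 0 ≤ D n := by
    intro n f hf
    rw [hDmem] at hf ⊢
    obtain ⟨p, q, ⟨i, hi⟩, rfl⟩ := hf
    have hev : ∀ p : (Rs 0)[X], eval₂ (Rs n).subtype z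
        (p.map (Subring.inclusion (hmono (Nat.zero_le n)))) = eval₂ (Rs 0).subtype z p := by
      intro p
      rw [eval₂_map]; rfl
    refine ⟨p.map (Subring.inclusion (hmono (Nat.zero_le n))),
      q.map (Subring.inclusion (hmono (Nat.zero_le n))), ⟨i, ?_⟩, ?_⟩
    · rw [coeff_map]; exact hi.map _
    · rw [hev, hev]
  have hxinv : ∀ n, ∀ j < n, (x j)⁻¹ ∉ D n := by
    intro n j hj h
    rw [hDmem] at h
    obtain ⟨p, q, ⟨i, hi⟩, he⟩ := h
    obtain ⟨hL, hN, hU, hxy⟩ := reg_props _ (hreg n)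
    have hxn : x j ∈ mSet (Rs n) := hmm hj.le (hxm j)
    have htr := aux_trans (Rs n) hL hU (hfr n) z (hcon n).1 (hcon n).2
    have hq0 : eval₂ (Rs n).subtype z q ≠ 0 := fun h0 => htr q h0 i hi
    obtain ⟨hxR, hxu⟩ := hxn
    have h1 : eval₂ (Rs n).subtype z (q - C ⟨x j, hxR⟩ * p) = 0 := by
      rw [eval₂_sub, eval₂_mul, eval₂_C]
      change _ - x j * _ = 0
      have := hx0 j
      field_simp at he
      rw [he]; ring
    have h2 := htr _ h1 i
    rw [coeff_sub, coeff_C_mul] at h2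
    have h3 : (⟨x j, hxR⟩ : Rs n) * p.coeff i ∈ nonunits (Rs n) :=
      mul_mem_nonunits_left hxu
    have h4 := IsLocalRing.nonunits_add (a := q.coeff i - (⟨x j, hxR⟩ : Rs n) * p.coeff i)
      (b := (⟨x j, hxR⟩ : Rs n) * p.coeff i) h2 h3
    rw [sub_add_cancel] at h4
    exact h4 hi
  obtain ⟨hN, hK⟩ := hDprop 0 ⟨C ⟨b, hb⟩ * X - C ⟨a, ha⟩, by
      intro h
      have := congrArg (fun p => coeff p 1) h
      simp [coeff_C] at this
      exact hb0 (by simpa using this), by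
      simp only [eval₂_sub, eval₂_mul, eval₂_C, eval₂_X]
      change b * z - a = 0
      rw [hzab, mul_div_cancel₀ _ hb0, sub_self]⟩
  have hfr' : ∀ f : F, ∃ d ∈ D 0, d ≠ 0 ∧ d * f ∈ D 0 := by
    intro f
    obtain ⟨u, hu, v, hv, hv0, rfl⟩ := hfr 0 f
    exact ⟨v, hRD 0 hv, hv0, by rw [mul_div_cancel₀ _ hv0]; exact hRD 0 hu⟩
  have hne : (⟨a, hRD 0 ha⟩ : D 0) ≠ 0 := fun h => ha0 (congrArg Subtype.val h)
  have hfin : ∀ n : ℕ, (n : ℕ∞) ≤ Ring.ord (D 0) ⟨a, hRD 0 ha⟩ := fun n =>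
    aux_chain (D 0) hfr' (D n) (hDD n) ⟨a, hRD 0 ha⟩ hne n c x (by simp [hc])
      (fun j _ => hcne j) (fun j _ => hcs j)
      (fun j hj => hRD n (hmono hj.le ((mem_mSet _ _).mp (hxm j)).1))
      (hxinv n) (hRD n (hdiv n).1)
  have htop : Ring.ord (D 0) ⟨a, hRD 0 ha⟩ ≠ ⊤ :=
    Ring.ord_ne_top (mem_nonZeroDivisors_of_ne_zero hne)
  exact htop (ENat.eq_top_iff_forall_ge.mpr hfin)

theorem exists_dom {F : Type*} [Field F] (Rs : ℕ → Subring F)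
    (hreg : ∀ i, IsRegLocal2 (Rs i))
    (hl : ∀ i, IsLQT (Rs i) (Rs (i + 1))) :
    ∃ V : ValuationSubring F, ∀ i : ℕ, Dominates (Rs i) V.toSubring := by
  have hmono : Monotone Rs := monotone_nat_of_le_succ fun i => (lqt_props _ _ (hl i)).1
  have hmm : Monotone fun i => mSet (Rs i) :=
    monotone_nat_of_le_succ fun i => (lqt_props _ _ (hl i)).2.1
  have hmemU : ∀ f, f ∈ (⨆ i, Rs i) ↔ ∃ i, f ∈ Rs i := fun f =>
    Subring.mem_iSup_of_directed hmono.directed_le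
  let I : Ideal (⨆ i, Rs i : Subring F) :=
    { carrier := {f | ∃ i, (f : F) ∈ mSet (Rs i)}
      zero_mem' := ⟨0, (mem_mSet _ _).mpr ⟨(Rs 0).zero_mem, Or.inl rfl⟩⟩
      add_mem' := by
        rintro f g ⟨i, hi⟩ ⟨j, hj⟩
        obtain ⟨hL, _⟩ := reg_props _ (hreg (max i j))
        obtain ⟨h1, h2⟩ := hmm (le_max_left i j) hi
        obtain ⟨h3, h4⟩ := hmm (le_max_right i j) hj
        exact ⟨max i j, (Rs (max i j)).add_mem h1 h3, IsLocalRing.nonunits_add h2 h4⟩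
      smul_mem' := by
        rintro ⟨r, hr⟩ f ⟨i, hi⟩
        obtain ⟨j, hj⟩ := (hmemU r).mp hr
        obtain ⟨h1, h2⟩ := hmm (le_max_left i j) hi
        have h3 := hmono (le_max_right i j) hj
        exact ⟨max i j, (Rs (max i j)).mul_mem h3 h1,
          mul_mem_nonunits_right (a := (⟨r, h3⟩ : Rs (max i j))) h2⟩ }
  have hI : I ≠ ⊤ := by
    rw [Ne, Ideal.eq_top_iff_one]
    rintro ⟨i, hi⟩
    have := ((mem_mSet _ _).mp hi).2
    simp at this
  obtain ⟨V, hV, hVI⟩ := Ideal.image_subset_nonunits_valuationSubring I hI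
  refine ⟨V, fun i => ⟨fun f hf => hV ((hmemU f).mpr ⟨i, hf⟩), fun f hf => ?_⟩⟩
  have hfU : f ∈ (⨆ i, Rs i) := (hmemU f).mpr ⟨i, hf⟩
  constructor
  · intro h
    have h1 : f ∈ V.nonunits := hVI ⟨⟨f, hfU⟩, ⟨i, h⟩, rfl⟩
    rw [mem_mSet]
    refine ⟨hV hfU, ?_⟩
    exact V.mem_nonunits_iff_or.mp h1
  · intro h
    rw [mem_mSet] at h ⊢
    exact ⟨hf, h.2.imp id fun h1 h2 => h1 (hV ((hmemU _).mpr ⟨i, h2⟩))⟩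

/-- Let `(R, 𝔪)` be a regular local ring of Krull dimension 2 with
field of fractions `F`, and `(R_i, 𝔪_i)_{i∈ℕ}` a simple sequence of local quadratic
transforms of `R`.  Then there is exactly one valuation subring `V` of `F` dominating
`R_i` for every `i` (i.e. `R_i ⊆ V` and `𝔪_i = R_i ∩ 𝔪_V`). -/
theorem unique_valuation_ring_dominating_simple_sequence
    (F : Type*) [Field F] (R : Subring F)
    (hR : IsRegLocal2 R) (hRF : IsFracField R)
    (Rs : ℕ → Subring F) (hseq : IsSimpleSeq R Rs) :
    ∃! V : ValuationSubring F, ∀ i : ℕ, Dominates (Rs i) V.toSubring := by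
  obtain ⟨h0, hs⟩ := hseq
  have hreg : ∀ i, IsRegLocal2 (Rs i) := by
    rintro (_ | i)
    · rw [h0]; exact hR
    · exact (hs i).2.1
  have hfr : ∀ i, IsFracField (Rs i) := by
    rintro (_ | i)
    · rw [h0]; exact hRF
    · exact (hs i).2.2
  have hl := fun i => (hs i).1
  obtain ⟨V, hV⟩ := exists_dom Rs hreg hl
  have hle : ∀ V W : ValuationSubring F, (∀ i : ℕ, Dominates (Rs i) V.toSubring) →
      (∀ i : ℕ, Dominates (Rs i) W.toSubring) → V ≤ W := by
    intro V W hV hW z hz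
    by_cases hz0 : z = 0
    · rw [hz0]; exact W.zero_mem
    obtain ⟨i, hi | hi⟩ := main_lemma Rs hreg hfr hl z
    · exact (hW i).1 hi
    · by_cases hm : z⁻¹ ∈ mSet (Rs i)
      · have h1 := ((mem_mSet _ _).mp (((hV i).2 _ hi).mp hm)).2
        rw [inv_inv] at h1
        exact absurd hz (h1.resolve_left (inv_ne_zero hz0))
      · rw [mem_mSet] at hm
        push Not at hm
        have := (hm hi).2
        rw [inv_inv] at this
        exact (hW i).1 this
  exact ⟨V, hV, fun W hW => le_antisymm (hle W V hW hV) (hle V W hV hW)⟩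
end

section
/- Let (R, 𝔪) be a regular local ring of Krull dimension 2, let (x, y) be a regular system of parameters of R, and let f ∈ R be a nonzero element of multiplicity μ := max{i ∈ ℕ : f ∈ 𝔪^i} ≥ 1 with f ∉ (x, y^{μ+1}). Let e := e(x, y, f) and let e₀ be the first characteristic exponent of f, and assume e < ∞. Then e < e₀ if and only if e is a (positive) integer and there exists a unit u ∈ R^× such that e(x, y − u x^e, f) > e(x, y, f). -/
open IsLocalRing

variable {R : Type*} [CommRing R] [IsLocalRing R]

/-- `I(x, y, f)`: the smallest monomial ideal with respect to `(x, y)` containing `f`,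
i.e. the intersection of all ideals generated by monomials `x^α y^β` that contain `f`. -/
def monIdeal (x y f : R) : Ideal R :=
  sInf {J : Ideal R |
    (∃ M : Set (ℕ × ℕ), J = Ideal.span ((fun p : ℕ × ℕ => x ^ p.1 * y ^ p.2) '' M)) ∧
    f ∈ J}

/-- `e(x, y, f) = min {α/(μ−β) : x^α y^β ∈ I(x,y,f), β < μ} ∈ ℝ ∪ {∞}`,
with the convention `min ∅ = ∞` (in `EReal`, `sInf ∅ = ⊤`). -/
noncomputable def eexp (x y f : R) (μ : ℕ) : EReal :=
  sInf {q : EReal | ∃ α β : ℕ, β < μ ∧ x ^ α * y ^ β ∈ monIdeal x y f ∧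
    q = (((α : ℝ) / ((μ : ℝ) - (β : ℝ)) : ℝ) : EReal)}

/-- The first characteristic exponent of `f` at `𝔪`: the supremum of `e(x', y', f)`
over all regular systems of parameters `(x', y')` of `R` with `f ∉ (x', y'^(μ+1))`. -/
noncomputable def charExp (f : R) (μ : ℕ) : EReal :=
  sSup {q : EReal | ∃ x' y' : R, maximalIdeal R = Ideal.span {x', y'} ∧
    f ∉ Ideal.span {x', y' ^ (μ + 1)} ∧ q = eexp x' y' f μ}


theorem aux_P [IsNoetherianRing R] (hdim : ringKrullDim R = 2) {x y : R}
    (h : maximalIdeal R = Ideal.span {x, y}) (k : ℕ) : y ^ k ∉ Ideal.span {x} := by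
  intro hk
  have hx : x ∈ maximalIdeal R := h ▸ Ideal.subset_span (by simp)
  have hmin : maximalIdeal R ∈ (Ideal.span {x}).minimalPrimes := by
    refine ⟨⟨inferInstance, by simpa [Ideal.span_le] using hx⟩, ?_⟩
    rintro q ⟨hq, hxq⟩ _
    rw [h, Ideal.span_le]
    rintro z (rfl | rfl)
    · exact hxq (Ideal.subset_span (by simp))
    · exact hq.mem_of_pow_mem k (hxq hk)
  have h1 := Ideal.height_le_one_of_isPrincipal_of_mem_minimalPrimes (Ideal.span {x}) _ hmin
  have h2 := IsLocalRing.maximalIdeal_height_eq_ringKrullDim (R := R)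
  rw [hdim] at h2
  have h3 : ((maximalIdeal R).height : WithBot ℕ∞) ≤ ((1 : ℕ∞) : WithBot ℕ∞) :=
    WithBot.coe_le_coe.mpr h1
  rw [h2] at h3
  have h4 : ((2 : ℕ∞) : WithBot ℕ∞) ≤ ((1 : ℕ∞) : WithBot ℕ∞) := h3
  rw [WithBot.coe_le_coe] at h4
  exact absurd h4 (by decide)

theorem aux_krull [IsNoetherianRing R] {x y g : R} (hy : y ∈ maximalIdeal R)
    (h : ∀ k : ℕ, g ∈ Ideal.span {x, y ^ k}) : x ∣ g := by
  have hne : (Ideal.span {y} : Ideal R) ≠ ⊤ := by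
    intro h
    rw [Ideal.span_singleton_eq_top] at h
    exact hy h
  have := Ideal.iInf_pow_smul_eq_bot_of_isLocalRing (M := R ⧸ Ideal.span {x}) _ hne
  rw [← Ideal.mem_span_singleton, ← Ideal.Quotient.eq_zero_iff_mem, ← Submodule.mem_bot R, ← this]
  rw [Submodule.mem_iInf]
  intro k
  obtain ⟨a, b, hab⟩ := Ideal.mem_span_pair.mp (h k)
  have : (Ideal.Quotient.mk (Ideal.span {x}) g) =
      y ^ k • (Ideal.Quotient.mk (Ideal.span {x}) b) := by
    rw [← hab, Algebra.smul_def]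
    simp only [map_add, map_mul, Ideal.Quotient.algebraMap_eq]
    have : Ideal.Quotient.mk (Ideal.span {x}) x = 0 :=
      Ideal.Quotient.eq_zero_iff_mem.mpr (Ideal.subset_span rfl)
    rw [this]; ring
  rw [this]
  exact Submodule.smul_mem_smul (Ideal.pow_mem_pow (Ideal.mem_span_singleton_self y) k) Submodule.mem_top

theorem aux_Q [IsNoetherianRing R] (hdim : ringKrullDim R = 2) {x y : R}
    (h : maximalIdeal R = Ideal.span {x, y}) {g : R} (hg : x ∣ y * g) : x ∣ g := by
  have hy : y ∈ maximalIdeal R := h ▸ Ideal.subset_span (by simp)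
  apply aux_krull hy
  intro k
  induction k with
  | zero => simp [Ideal.mem_span_pair]; exact ⟨0, g, by ring⟩
  | succ k ih =>
    obtain ⟨a, b, hab⟩ := Ideal.mem_span_pair.mp ih
    have hb : b ∈ maximalIdeal R := by
      intro hb
      obtain ⟨b', hb'⟩ := hb.exists_left_inv
      obtain ⟨c, hc⟩ := hg
      apply aux_P hdim h (k + 1)
      rw [Ideal.mem_span_singleton]
      refine ⟨b' * (c - a * y), ?_⟩
      have : b * y ^ (k+1) = x * (c - a * y) := by
        rw [← hab] at hc
        linear_combination hc
      linear_combination b' * this - y^(k+1) * hb'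
    rw [h] at hb
    obtain ⟨p, q, hpq⟩ := Ideal.mem_span_pair.mp hb
    exact Ideal.mem_span_pair.mpr ⟨a + p * y ^ k, q, by rw [← hab, ← hpq]; ring⟩

theorem aux_Q2 [IsDomain R] [IsNoetherianRing R] (hdim : ringKrullDim R = 2) {x y : R}
    (h : maximalIdeal R = Ideal.span {x, y}) (a k : ℕ) {g : R} (hg : x ^ a ∣ y ^ k * g) :
    x ^ a ∣ g := by
  have hx0 : x ≠ 0 := by
    rintro rfl
    have h' : maximalIdeal R = Ideal.span {y, 0} := by rw [h, Set.pair_comm]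
    exact aux_P hdim h' 1 (by simp)
  induction k with
  | zero => simpa using hg
  | succ k ih =>
    apply ih
    clear ih
    have key : ∀ (a : ℕ) (g : R), x ^ a ∣ y * g → x ^ a ∣ g := by
      intro a
      induction a with
      | zero => simp
      | succ a iha =>
        intro g hg
        obtain ⟨c, hc⟩ := hg
        obtain ⟨d, rfl⟩ := aux_Q hdim h (g := g) ⟨x ^ a * c, by rw [hc]; ring⟩
        rw [pow_succ']
        apply mul_dvd_mul_left
        apply iha
        refine ⟨c, mul_left_cancel₀ hx0 ?_⟩
        linear_combination hc
    apply key
    rwa [pow_succ', mul_assoc] at hg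

theorem aux_1 [IsDomain R] [IsNoetherianRing R] (hdim : ringKrullDim R = 2) {x y : R}
    (h : maximalIdeal R = Ideal.span {x, y}) (a k : ℕ) {g : R}
    (hg : y ^ k * g ∈ Ideal.span {x ^ a, y ^ (k + 1)}) : g ∈ Ideal.span {x ^ a, y} := by
  obtain ⟨p, q, hpq⟩ := Ideal.mem_span_pair.mp hg
  obtain ⟨c, hc⟩ := aux_Q2 hdim h a k (g := g - q * y) ⟨p, by linear_combination -hpq⟩
  exact Ideal.mem_span_pair.mpr ⟨c, q, by linear_combination -hc⟩

theorem aux_2 [IsDomain R] [IsNoetherianRing R] (hdim : ringKrullDim R = 2) {x y : R}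
    (h : maximalIdeal R = Ideal.span {x, y}) (a b : ℕ) :
    x ^ a * y ^ b ∉ Ideal.span {x ^ (a + 1), y ^ (b + 1)} := by
  intro hg
  rw [mul_comm] at hg
  obtain ⟨p, q, hpq⟩ := Ideal.mem_span_pair.mp (aux_1 hdim h (a + 1) b hg)
  have hx : x ∈ maximalIdeal R := h ▸ Ideal.subset_span (by simp)
  have hu : IsUnit (1 - p * x) := by
    by_contra hu
    have h1 : 1 - p * x ∈ maximalIdeal R := hu
    have : (1 : R) ∈ maximalIdeal R := by
      simpa using Ideal.add_mem _ h1 (Ideal.mul_mem_left _ p hx)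
    exact (Ideal.ne_top_iff_one _).mp (Ideal.IsPrime.ne_top inferInstance) this
  obtain ⟨v, hv⟩ := hu.exists_left_inv
  have h' : maximalIdeal R = Ideal.span {y, x} := by rw [h, Set.pair_comm]
  apply aux_P hdim h' a
  rw [Ideal.mem_span_singleton]
  exact ⟨v * q, by linear_combination (-v) * hpq - x ^ a * hv⟩

theorem aux_mon [IsDomain R] [IsNoetherianRing R] (hdim : ringKrullDim R = 2) {x y : R}
    (h : maximalIdeal R = Ideal.span {x, y}) (f : R) (a b : ℕ) :
    x ^ a * y ^ b ∈ monIdeal x y f ↔ f ∉ Ideal.span {x ^ (a + 1), y ^ (b + 1)} := by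
  constructor
  · intro hm hf
    rw [monIdeal, Submodule.mem_sInf] at hm
    refine aux_2 hdim h a b (hm _ ⟨⟨{(a + 1, 0), (0, b + 1)}, ?_⟩, hf⟩)
    rw [Set.image_pair]; simp
  · intro hf
    rw [monIdeal, Submodule.mem_sInf]
    rintro J ⟨⟨M, rfl⟩, hJ⟩
    by_contra hc
    apply hf
    refine (Ideal.span_le.mpr ?_ : Ideal.span _ ≤ _) hJ
    rintro _ ⟨⟨i, j⟩, hij, rfl⟩
    by_cases hi : a + 1 ≤ i
    · exact Ideal.mul_mem_right _ _ (Ideal.mem_of_dvd _ (pow_dvd_pow x hi)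
        (Ideal.subset_span (by simp)))
    by_cases hj : b + 1 ≤ j
    · exact Ideal.mul_mem_left _ _ (Ideal.mem_of_dvd _ (pow_dvd_pow y hj)
        (Ideal.subset_span (by simp)))
    have hmem : x ^ i * y ^ j ∈ Ideal.span ((fun p : ℕ × ℕ => x ^ p.1 * y ^ p.2) '' M) :=
      Ideal.subset_span ⟨(i, j), hij, rfl⟩
    exact absurd (Ideal.mem_of_dvd _ (mul_dvd_mul (pow_dvd_pow x (by omega : i ≤ a))
      (pow_dvd_pow y (by omega : j ≤ b))) hmem) hc

/-- Weighted monomial ideal. -/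
def wI (s t : ℝ) (x y : R) : Ideal R :=
  Ideal.span {z | ∃ a b : ℕ, t ≤ a + s * b ∧ z = x ^ a * y ^ b}

theorem wI_gen {s t : ℝ} (x y : R) {a b : ℕ} (h : t ≤ a + s * b) :
    x ^ a * y ^ b ∈ wI s t x y := Ideal.subset_span ⟨a, b, h, rfl⟩

theorem wI_mul {s t t' : ℝ} {x y z z' : R} (h : z ∈ wI s t x y) (h' : z' ∈ wI s t' x y) :
    z * z' ∈ wI s (t + t') x y := by
  have : wI s t x y * wI s t' x y ≤ wI s (t + t') x y := by
    rw [wI, wI, Ideal.span_mul_span, Ideal.span_le]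
    rintro _ ⟨_, ⟨a, b, hab, rfl⟩, _, ⟨c, d, hcd, rfl⟩, rfl⟩
    refine Ideal.subset_span ⟨a + c, b + d, by push_cast; linarith, by ring⟩
  exact this (Ideal.mul_mem_mul h h')

theorem wI_pow {s t : ℝ} {x y z : R} (h : z ∈ wI s t x y) (n : ℕ) :
    z ^ n ∈ wI s (n * t) x y := by
  induction n with
  | zero => simpa using wI_gen (s := s) (t := 0) x y (a := 0) (b := 0) (by simp)
  | succ n ih =>
    have := wI_mul ih h
    rw [pow_succ]
    convert this using 2
    push_cast; ring

theorem wI_anti {s t t' : ℝ} (x y : R) (h : t ≤ t') : wI s t' x y ≤ wI s t x y := by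
  rw [wI, Ideal.span_le]
  rintro _ ⟨a, b, hab, rfl⟩
  exact wI_gen x y (h.trans hab)

theorem wI_transport {s : ℝ} {x y x' y' : R} (hx : x' ∈ wI s 1 x y) (hy : y' ∈ wI s s x y)
    (t : ℝ) : wI s t x' y' ≤ wI s t x y := by
  rw [wI, Ideal.span_le]
  rintro _ ⟨a, b, hab, rfl⟩
  exact wI_anti x y (by linarith) (wI_mul (wI_pow hx a) (wI_pow hy b))

theorem wI_le {s s' : ℝ} (μ : ℕ) (x y : R) (hs : 0 ≤ s) (h : s ≤ s') :
    wI s' (s' * μ) x y ≤ wI s (s * μ) x y := by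
  rw [wI, Ideal.span_le]
  rintro _ ⟨a, b, hab, rfl⟩
  refine wI_gen x y ?_
  have ha : (0:ℝ) ≤ a := Nat.cast_nonneg _
  rcases le_total (μ:ℝ) b with hb | hb
  · nlinarith
  · nlinarith

theorem le_eexp_iff [IsDomain R] [IsNoetherianRing R] (hdim : ringKrullDim R = 2) {x y : R}
    (h : maximalIdeal R = Ideal.span {x, y}) (f : R) (μ : ℕ) {s : ℝ} (hs : 0 ≤ s) :
    (s : EReal) ≤ eexp x y f μ ↔ f ∈ wI s (s * μ) x y := by
  constructor
  · intro hle
    have H : ∀ a b : ℕ, b < μ → (a : ℝ) < s * (μ - b) →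
        f ∈ Ideal.span {x ^ (a + 1), y ^ (b + 1)} := by
      intro a b hb hab
      by_contra hc
      have h1 : eexp x y f μ ≤ (((a : ℝ) / ((μ : ℝ) - (b : ℝ)) : ℝ) : EReal) :=
        sInf_le ⟨a, b, hb, (aux_mon hdim h f a b).mpr hc, rfl⟩
      have h2 := hle.trans h1
      rw [EReal.coe_le_coe_iff] at h2
      have hb' : (0:ℝ) < μ - b := by
        have : (b:ℝ) < μ := by exact_mod_cast hb
        linarith
      rw [le_div_iff₀ hb'] at h2
      linarith
    have K : ∀ k : ℕ, k ≤ μ → ∃ r g, f = r + y ^ k * g ∧ r ∈ wI s (s * μ) x y ∧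
        x ^ (⌈s * (μ - k)⌉₊) ∣ r := by
      intro k
      induction k with
      | zero => intro _; exact ⟨0, f, by simp, by simp, by simp⟩
      | succ k ih =>
        intro hk
        obtain ⟨r, g, hf, hr, hdvd⟩ := ih (by omega)
        set a := ⌈s * (μ - k)⌉₊ with ha
        have hfm : f ∈ Ideal.span {x ^ a, y ^ (k + 1)} := by
          rcases Nat.eq_zero_or_pos a with h0 | h0
          · rw [h0]; exact Ideal.mem_span_pair.mpr ⟨f, 0, by simp⟩
          · have := H (a - 1) k (by omega) (Nat.lt_ceil.mp (by omega))
            rwa [Nat.sub_add_cancel h0] at this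
        have hyg : y ^ k * g ∈ Ideal.span {x ^ a, y ^ (k + 1)} := by
          have : y ^ k * g = f - r := by rw [hf]; ring
          rw [this]
          exact Ideal.sub_mem _ hfm (Ideal.mem_of_dvd _ hdvd (Ideal.subset_span (by simp)))
        obtain ⟨p, q, hpq⟩ := Ideal.mem_span_pair.mp (aux_1 hdim h a k hyg)
        refine ⟨r + p * (x ^ a * y ^ k), q, ?_, ?_, ?_⟩
        · rw [hf, ← hpq]; ring
        · refine Ideal.add_mem _ hr (Ideal.mul_mem_left _ _ (wI_gen x y ?_))
          have := Nat.le_ceil (s * ((μ:ℝ) - k))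
          rw [← ha] at this
          linarith
        · have hle : ⌈s * ((μ:ℝ) - (k + 1 : ℕ))⌉₊ ≤ a := by
            apply Nat.ceil_mono
            apply mul_le_mul_of_nonneg_left _ hs
            push_cast; linarith
          refine dvd_trans (pow_dvd_pow x hle) (dvd_add hdvd ?_)
          exact Dvd.intro_left (p * y ^ k) (by ring)
    obtain ⟨r, g, hf, hr, -⟩ := K μ le_rfl
    rw [hf]
    refine Ideal.add_mem _ hr (Ideal.mul_mem_right _ _ ?_)
    simpa using wI_gen x y (s := s) (t := s * μ) (a := 0) (b := μ) (by simp)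
  · intro hf
    apply le_sInf
    rintro _ ⟨a, b, hb, hm, rfl⟩
    rw [EReal.coe_le_coe_iff]
    have hb' : (0:ℝ) < μ - b := by
      have : (b:ℝ) < μ := by exact_mod_cast hb
      linarith
    rw [le_div_iff₀ hb']
    by_contra hc
    push Not at hc
    refine (aux_mon hdim h f a b).mp hm ?_
    refine (Ideal.span_le.mpr ?_ : wI s (s * μ) x y ≤ _) hf
    rintro _ ⟨i, j, hij, rfl⟩
    by_cases hi : a + 1 ≤ i
    · exact Ideal.mul_mem_right _ _ (Ideal.mem_of_dvd _ (pow_dvd_pow x hi)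
        (Ideal.subset_span (by simp)))
    by_cases hj : b + 1 ≤ j
    · exact Ideal.mul_mem_left _ _ (Ideal.mem_of_dvd _ (pow_dvd_pow y hj)
        (Ideal.subset_span (by simp)))
    exfalso
    have h1 : (i:ℝ) ≤ a := by exact_mod_cast (by omega : i ≤ a)
    have h2 : (j:ℝ) ≤ b := by exact_mod_cast (by omega : j ≤ b)
    nlinarith

theorem pair_mul {x y z z' : R} {i j : ℕ} (h : z ∈ Ideal.span {x, y ^ i})
    (h' : z' ∈ Ideal.span {x, y ^ j}) : z * z' ∈ Ideal.span {x, y ^ (i + j)} := by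
  obtain ⟨a, b, rfl⟩ := Ideal.mem_span_pair.mp h
  obtain ⟨c, d, rfl⟩ := Ideal.mem_span_pair.mp h'
  exact Ideal.mem_span_pair.mpr ⟨a * (c * x + d * y ^ j) + b * y ^ i * c, b * d, by ring⟩

theorem pair_pow {x y z : R} {i : ℕ} (h : z ∈ Ideal.span {x, y ^ i}) (n : ℕ) :
    z ^ n ∈ Ideal.span {x, y ^ (i * n)} := by
  induction n with
  | zero => simp [Ideal.mem_span_pair]; exact ⟨0, 1, by ring⟩
  | succ n ih => rw [pow_succ]; exact pair_mul ih h

theorem pair_mono {x y : R} {i j : ℕ} (h : j ≤ i) :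
    Ideal.span {x, y ^ i} ≤ Ideal.span {x, y ^ j} := by
  rw [Ideal.span_le]
  rintro z (rfl | rfl)
  · exact Ideal.subset_span (by simp)
  · exact Ideal.mem_of_dvd _ (pow_dvd_pow y h) (Ideal.subset_span (by simp))

theorem eexp_real_le [IsDomain R] [IsNoetherianRing R] (hdim : ringKrullDim R = 2) {x y : R}
    (h : maximalIdeal R = Ideal.span {x, y}) {f : R} {μ : ℕ}
    (hμmem : f ∈ maximalIdeal R ^ μ) : ((1 : ℝ) : EReal) ≤ eexp x y f μ := by
  rw [le_eexp_iff hdim h f μ zero_le_one]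
  have hle : maximalIdeal R ≤ wI 1 1 x y := by
    rw [h, Ideal.span_le]
    rintro z (rfl | rfl)
    · simpa using wI_gen z y (s := 1) (t := 1) (a := 1) (b := 0) (by simp)
    · simpa using wI_gen x z (s := 1) (t := 1) (a := 0) (b := 1) (by simp)
  have hpow : ∀ k : ℕ, maximalIdeal R ^ k ≤ wI 1 (1 * k) x y := by
    intro k
    induction k with
    | zero =>
      intro z _
      have := wI_gen x y (s := 1) (t := 0) (a := 0) (b := 0) (by simp)
      simpa using Ideal.mul_mem_left _ z this
    | succ k ih =>
      rw [pow_succ, Ideal.mul_le]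
      intro r hr t ht
      have := wI_mul (ih hr) (hle ht)
      convert this using 2
      push_cast; ring
  exact hpow μ hμmem

/-- A system `(x', y')` with larger exponent has `y'` transversal to `x`. -/
theorem exists_coord {x y x' y' f : R} {μ : ℕ} {s : ℝ}
    (hμ1 : 1 ≤ μ) (hs : 1 < s)
    (h : maximalIdeal R = Ideal.span {x, y}) (h' : maximalIdeal R = Ideal.span {x', y'})
    (hnot : f ∉ Ideal.span {x, y ^ (μ + 1)})
    (hf : f ∈ wI s (s * μ) x' y') : maximalIdeal R = Ideal.span {x, y'} := by
  have hx' : x' ∈ Ideal.span {x, y ^ 1} := by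
    rw [pow_one, ← h, h']; exact Ideal.subset_span (by simp)
  have hy' : y' ∈ Ideal.span {x, y} := by
    rw [← h, h']; exact Ideal.subset_span (by simp)
  obtain ⟨b, a, hab⟩ := Ideal.mem_span_pair.mp hy'
  have ha : IsUnit a := by
    by_contra ha
    have ham : a ∈ maximalIdeal R := ha
    rw [h] at ham
    obtain ⟨p, q, hpq⟩ := Ideal.mem_span_pair.mp ham
    have hy2 : y' ∈ Ideal.span {x, y ^ 2} :=
      Ideal.mem_span_pair.mpr ⟨b + p * y, q, by rw [← hab, ← hpq]; ring⟩
    apply hnot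
    refine (Ideal.span_le.mpr ?_ : wI s (s * μ) x' y' ≤ _) hf
    rintro _ ⟨i, j, hij, rfl⟩
    refine pair_mono ?_ (pair_mul (pair_pow hx' i) (pair_pow hy2 j))
    rcases le_or_gt μ j with hj | hj
    · omega
    · have hj' : (j : ℝ) < μ := by exact_mod_cast hj
      have : (μ : ℝ) < i + j := by nlinarith
      have : μ < i + j := by exact_mod_cast this
      omega
  obtain ⟨v, hv⟩ := ha.exists_left_inv
  rw [h]
  apply le_antisymm
  · rw [Ideal.span_le]
    rintro z (rfl | rfl)
    · exact Ideal.subset_span (by simp)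
    · exact Ideal.mem_span_pair.mpr ⟨-v * b, v, by linear_combination z * hv - v * hab⟩
  · rw [Ideal.span_le]
    rintro z (rfl | rfl)
    · exact Ideal.subset_span (by simp)
    · exact hy'

theorem wI_of_pair {s t : ℝ} (ht : t ≤ s) {n : ℕ} (hn : t ≤ n) {x y z : R}
    (h : z ∈ Ideal.span {x ^ n, y}) : z ∈ wI s t x y := by
  refine (Ideal.span_le.mpr ?_ : Ideal.span {x ^ n, y} ≤ _) h
  rintro w (rfl | rfl)
  · simpa using wI_gen x y (s := s) (t := t) (a := n) (b := 0) (by simpa using hn)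
  · simpa using wI_gen x w (s := s) (t := t) (a := 0) (b := 1) (by simpa using ht)

theorem aux_contra [IsDomain R] [IsNoetherianRing R] (hdim : ringKrullDim R = 2) {x y y' u w f : R}
    (h : maximalIdeal R = Ideal.span {x, y}) (h' : maximalIdeal R = Ideal.span {x, y'})
    {μ n : ℕ} (hμ1 : 1 ≤ μ) {t : ℝ} (hn : n < t) (hu : IsUnit u) (hw : IsUnit w)
    (hy : y = u * x ^ n + w * y')
    (hnot : f ∉ Ideal.span {x, y' ^ (μ + 1)})
    (hf : f ∈ wI t (t * μ) x y) (hf' : f ∈ wI t (t * μ) x y') : False := by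
  have ht : 0 < t := lt_of_le_of_lt (Nat.cast_nonneg n) hn
  obtain ⟨v, hv⟩ := hw.exists_left_inv
  have h1 : f ∈ Ideal.span {x ^ (n * μ + 1), y} := by
    refine (Ideal.span_le.mpr ?_ : wI t (t * μ) x y ≤ _) hf
    rintro _ ⟨i, j, hij, rfl⟩
    rcases Nat.eq_zero_or_pos j with rfl | hj
    · have hμ' : (1:ℝ) ≤ μ := by exact_mod_cast hμ1
      have : ((n * μ : ℕ) : ℝ) < i := by push_cast at *; nlinarith
      have : n * μ < i := by exact_mod_cast this
      exact Ideal.mul_mem_right _ _ (Ideal.mem_of_dvd _ (pow_dvd_pow x this)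
        (Ideal.subset_span (by simp)))
    · exact Ideal.mul_mem_left _ _ (Ideal.mem_of_dvd _ (dvd_pow_self y (by omega))
        (Ideal.subset_span (by simp)))
  have h2 : wI t (t * μ) x y' ≤ Ideal.span {y' ^ μ} ⊔
      (Ideal.span {x} ⊓ Ideal.span {x ^ (n * μ + 1), y}) := by
    rw [wI, Ideal.span_le]
    rintro _ ⟨i, j, hij, rfl⟩
    rcases le_or_gt μ j with hj | hj
    · exact Ideal.mem_sup_left (Ideal.mul_mem_left _ _ (Ideal.mem_span_singleton.mpr
        (pow_dvd_pow y' hj)))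
    · have hj' : (j : ℝ) < μ := by exact_mod_cast hj
      have hlt : ((n * μ : ℕ) : ℝ) < (i + n * j : ℕ) := by push_cast; nlinarith
      have hlt : n * μ < i + n * j := by exact_mod_cast hlt
      have hi : 0 < i := by
        rcases Nat.eq_zero_or_pos i with rfl | hi
        · have := Nat.mul_le_mul_left n hj.le
          omega
        · exact hi
      refine Ideal.mem_sup_right ⟨Ideal.mul_mem_right _ _ (Ideal.mem_span_singleton.mpr
        (dvd_pow_self x hi.ne')), ?_⟩
      have hd : y ∣ y' ^ j - (-(v * u * x ^ n)) ^ j := by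
        refine dvd_trans ?_ (sub_dvd_pow_sub_pow _ _ j)
        exact ⟨v, by rw [hy]; linear_combination -y' * hv⟩
      obtain ⟨c, hc⟩ := hd
      have hle : x ^ (n * μ + 1) ∣ x ^ (i + n * j) := pow_dvd_pow x hlt
      obtain ⟨d, hd⟩ := hle
      refine Ideal.mem_span_pair.mpr ⟨d * (-(v * u)) ^ j, x ^ i * c, ?_⟩
      have e1 : (-(v * u * x ^ n)) ^ j = (-(v * u)) ^ j * x ^ (n * j) := by
        rw [pow_mul, ← mul_pow]; ring
      rw [e1] at hc
      rw [pow_add] at hd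
      linear_combination (-(v * u)) ^ j * (-hd) - x ^ i * hc
  obtain ⟨a, ha, r, ⟨hr1, hr2⟩, har⟩ := Submodule.mem_sup.mp (h2 hf')
  obtain ⟨c, rfl⟩ := Ideal.mem_span_singleton.mp ha
  obtain ⟨r', hr'⟩ := Ideal.mem_span_singleton.mp hr1
  have hc : IsUnit c := by
    by_contra hc
    have hcm : c ∈ maximalIdeal R := hc
    rw [h'] at hcm
    obtain ⟨p, q, hpq⟩ := Ideal.mem_span_pair.mp hcm
    apply hnot
    exact Ideal.mem_span_pair.mpr ⟨p * y' ^ μ + r', q, by rw [← har, hr', ← hpq]; ring⟩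
  have h3 : y' ^ μ * c ∈ Ideal.span {x ^ (n * μ + 1), y} := by
    have : y' ^ μ * c = f - r := by rw [← har]; ring
    rw [this]; exact Ideal.sub_mem _ h1 hr2
  obtain ⟨c', hc'⟩ := hc.exists_left_inv
  obtain ⟨u', hu'⟩ := hu.exists_left_inv
  have hd : y ∣ (w * y') ^ μ - (-(u * x ^ n)) ^ μ := by
    refine dvd_trans ?_ (sub_dvd_pow_sub_pow _ _ μ)
    exact ⟨1, by rw [hy]; ring⟩
  have h4 : (w * y') ^ μ ∈ Ideal.span {x ^ (n * μ + 1), y} := by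
    have : (w * y') ^ μ = (w ^ μ * c') * (y' ^ μ * c) := by
      rw [mul_pow]; linear_combination -w ^ μ * y' ^ μ * hc'
    rw [this]; exact Ideal.mul_mem_left _ _ h3
  have h5 : (-(u * x ^ n)) ^ μ ∈ Ideal.span {x ^ (n * μ + 1), y} := by
    have := Ideal.sub_mem _ h4 (Ideal.mem_of_dvd _ hd (Ideal.subset_span (by simp)))
    simpa using this
  have h6 : x ^ (n * μ) ∈ Ideal.span {x ^ (n * μ + 1), y} := by
    have : x ^ (n * μ) = (-u') ^ μ * (-(u * x ^ n)) ^ μ := by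
      rw [← mul_pow, pow_mul]
      congr 1
      linear_combination -x ^ n * hu'
    rw [this]; exact Ideal.mul_mem_left _ _ h5
  exact aux_2 hdim h (n * μ) 0 (by simpa using h6)

set_option maxHeartbeats 1000000 in
/-- Let `(R, 𝔪)` be a regular local ring of Krull dimension 2,
`(x, y)` a regular system of parameters, and `f ∈ R` nonzero of multiplicity
`μ = max {i : f ∈ 𝔪^i} ≥ 1` with `f ∉ (x, y^(μ+1))`.  Let `e = e(x, y, f)` and let
`e₀` be the first characteristic exponent of `f`, and assume `e < ∞`.  Then `e < e₀`
if and only if `e` is a positive integer and there is a unit `u ∈ R` with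
`e(x, y − u x^e, f) > e(x, y, f)`. -/
theorem first_characteristic_exponent_criterion
    [IsDomain R] [IsNoetherianRing R]
    (hdim : ringKrullDim R = 2)
    (x y : R) (hxy : maximalIdeal R = Ideal.span {x, y})
    (f : R) (hf0 : f ≠ 0) (μ : ℕ) (hμ1 : 1 ≤ μ)
    (hμmem : f ∈ maximalIdeal R ^ μ) (hμnotmem : f ∉ maximalIdeal R ^ (μ + 1))
    (hnot : f ∉ Ideal.span {x, y ^ (μ + 1)})
    (hfin : eexp x y f μ ≠ ⊤) :
    eexp x y f μ < charExp f μ ↔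
      ∃ n : ℕ, 1 ≤ n ∧ eexp x y f μ = (n : EReal) ∧
        ∃ u : R, IsUnit u ∧ eexp x y f μ < eexp x (y - u * x ^ n) f μ := by
  have hxm : x ∈ maximalIdeal R := hxy ▸ Ideal.subset_span (by simp)
  constructor
  · intro hlt
    obtain ⟨_, ⟨x', y', hxy', -, rfl⟩, hlt'⟩ := lt_sSup_iff.mp hlt
    obtain ⟨s, hs1, hs2⟩ := EReal.lt_iff_exists_real_btwn.mp hlt'
    have he1 := eexp_real_le hdim hxy hμmem
    have hs : 1 < s := by exact_mod_cast he1.trans_lt hs1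
    have hs0 : 0 ≤ s := by linarith
    have hf' := (le_eexp_iff hdim hxy' f μ hs0).mp hs2.le
    have hm := exists_coord hμ1 hs hxy hxy' hnot hf'
    have hx'm : x' ∈ Ideal.span {x ^ 1, y'} := by
      rw [pow_one, ← hm, hxy']; exact Ideal.subset_span (by simp)
    have hy's : y' ∈ wI s s x y' := by
      simpa using wI_gen x y' (s := s) (t := s) (a := 0) (b := 1) (by simp)
    have hf1 : f ∈ wI s (s * μ) x y' :=
      wI_transport (wI_of_pair hs.le (by simp) hx'm) hy's _ hf'
    have hxw : ∀ (t : ℝ) (z : R), x ∈ wI t 1 x z := fun t z => by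
      simpa using wI_gen x z (s := t) (t := 1) (a := 1) (b := 0) (by simp)
    have hunit : ∀ (n : ℕ) (u w : R), 1 ≤ n → y = u * x ^ n + w * y' → IsUnit w := by
      intro n u w hn hy
      by_contra hw
      have hwm : w ∈ Ideal.span {x, y ^ 1} := by rw [pow_one, ← hxy]; exact hw
      have hym : y' ∈ Ideal.span {x, y ^ 1} := by
        rw [pow_one, ← hxy, hm]; exact Ideal.subset_span (by simp)
      have h2 : y ∈ Ideal.span {x, y ^ 2} := by
        have h31 : w * y' ∈ Ideal.span {x, y ^ 2} := by
          have h32 := pair_mul hwm hym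
          norm_num only at h32
          exact h32
        have hxs : x ∈ Ideal.span {x, y ^ 2} := Ideal.subset_span (by simp)
        have h33 : u * x ^ n ∈ Ideal.span {x, y ^ 2} :=
          Ideal.mul_mem_left _ _ (Ideal.mem_of_dvd _ (dvd_pow_self x (by omega)) hxs)
        have h3 := Ideal.add_mem _ h33 h31
        rwa [← hy] at h3
      exact aux_2 hdim hxy 0 1 (by simpa using h2)
    have hbound : ∀ (n : ℕ) (u w : R), 1 ≤ n → y = u * x ^ n + w * y' →
        ((n : ℝ) : EReal) ≤ eexp x y f μ := by
      intro n u w hn hy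
      obtain ⟨v, hv⟩ := (hunit n u w hn hy).exists_left_inv
      have ht0 : 0 ≤ min s n := le_min hs0 (Nat.cast_nonneg n)
      have hmem : f ∈ wI (min s n) (min s n * μ) x y := by
        refine wI_transport (hxw _ _) ?_ _ (wI_le μ x y' ht0 (min_le_left s (n:ℝ)) hf1)
        refine wI_of_pair le_rfl (min_le_right s (n:ℝ)) ?_
        exact Ideal.mem_span_pair.mpr ⟨-v * u, v, by rw [hy]; linear_combination y' * hv⟩
      have hle := (le_eexp_iff hdim hxy f μ ht0).mpr hmem
      rcases le_total s n with h | h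
      · rw [min_eq_left h] at hle
        exact absurd hle (not_le.mpr hs1)
      · rwa [min_eq_right h] at hle
    have hord : ∃ n : ℕ, ∃ u w : R, 1 ≤ n ∧ IsUnit u ∧ y = u * x ^ n + w * y' := by
      by_contra hno
      have hall : ∀ k : ℕ, 1 ≤ k → ∃ u w : R, y = u * x ^ k + w * y' := by
        intro k hk
        induction k, hk using Nat.le_induction with
        | base =>
          have : y ∈ Ideal.span {x, y'} := by
            rw [← hm, hxy]; exact Ideal.subset_span (by simp)
          obtain ⟨a, b, hab⟩ := Ideal.mem_span_pair.mp this
          exact ⟨a, b, by rw [← hab]; ring⟩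
        | succ k hk ih =>
          obtain ⟨u, w, hy⟩ := ih
          have hu : ¬ IsUnit u := fun hu => hno ⟨k, u, w, hk, hu, hy⟩
          have hum : u ∈ Ideal.span {x, y'} := by rw [← hm]; exact hu
          obtain ⟨a, b, hab⟩ := Ideal.mem_span_pair.mp hum
          exact ⟨a, w + b * x ^ k, by
            have : y = (a * x + b * y') * x ^ k + w * y' := by rw [hab]; exact hy
            linear_combination this⟩
      obtain ⟨N, hN⟩ := exists_nat_gt s
      have hN1 : 1 ≤ N := by
        have : (0:ℝ) < N := by linarith
        exact_mod_cast this
      obtain ⟨u, w, hy⟩ := hall N hN1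
      have h1 := (hbound N u w hN1 hy).trans_lt hs1
      have h2 : (N:ℝ) < s := by exact_mod_cast h1
      linarith
    obtain ⟨n, u, w, hn, hu, hy⟩ := hord
    have hw := hunit n u w hn hy
    obtain ⟨v, hv⟩ := hw.exists_left_inv
    have hnle := hbound n u w hn hy
    have hnot' : f ∉ Ideal.span {x, y' ^ (μ + 1)} := by
      intro hc
      apply hnot
      have hym : y' ∈ Ideal.span {x, y ^ 1} := by
        rw [pow_one, ← hxy, hm]; exact Ideal.subset_span (by simp)
      refine (Ideal.span_le.mpr ?_ : Ideal.span {x, y' ^ (μ + 1)} ≤ _) hc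
      rintro z (rfl | rfl)
      · exact Ideal.subset_span (by simp)
      · simpa using pair_pow hym (μ + 1)
    have heq : eexp x y f μ = ((n : ℝ) : EReal) := by
      refine le_antisymm (le_of_not_gt fun hgt => ?_) hnle
      obtain ⟨t, ht1, ht2⟩ := EReal.lt_iff_exists_real_btwn.mp hgt
      have htn : (n : ℝ) < t := by exact_mod_cast ht1
      have ht0 : 0 ≤ t := le_trans (Nat.cast_nonneg n) htn.le
      have hts : t ≤ s := by
        have := (ht2.trans hs1).le
        exact_mod_cast this
      exact aux_contra hdim hxy hm hμ1 htn hu hw hy hnot'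
        ((le_eexp_iff hdim hxy f μ ht0).mp ht2.le) (wI_le μ x y' ht0 hts hf1)
    refine ⟨n, hn, by rw [heq]; rfl, u, hu, hs1.trans_le ?_⟩
    have hwy : y - u * x ^ n = w * y' := by rw [hy]; ring
    have hm2 : maximalIdeal R = Ideal.span {x, y - u * x ^ n} := by
      rw [hm, hwy]
      apply le_antisymm
      · rw [Ideal.span_le]
        rintro z (rfl | rfl)
        · exact Ideal.subset_span (by simp)
        · exact Ideal.mem_span_pair.mpr ⟨0, v, by linear_combination z * hv⟩
      · rw [Ideal.span_le]
        rintro z (rfl | rfl)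
        · exact Ideal.subset_span (by simp)
        · exact Ideal.mul_mem_left _ _ (Ideal.subset_span (by simp))
    rw [le_eexp_iff hdim hm2 f μ hs0]
    refine wI_transport (hxw _ _) ?_ _ hf1
    have hg := wI_gen x (y - u * x ^ n) (s := s) (t := s) (a := 0) (b := 1) (by simp)
    have : y' = v * (x ^ 0 * (y - u * x ^ n) ^ 1) := by
      rw [hwy]; linear_combination -y' * hv
    rw [this]
    exact Ideal.mul_mem_left _ _ hg
  · rintro ⟨n, hn, -, u, hu, hlt⟩
    refine hlt.trans_le (le_sSup ⟨x, y - u * x ^ n, ?_, ?_, rfl⟩)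
    · obtain ⟨k, rfl⟩ : ∃ k, n = k + 1 := ⟨n - 1, by omega⟩
      rw [hxy]
      apply le_antisymm
      · rw [Ideal.span_le]
        rintro z (rfl | rfl)
        · exact Ideal.subset_span (by simp)
        · exact Ideal.mem_span_pair.mpr ⟨u * x ^ k, 1, by ring⟩
      · rw [Ideal.span_le]
        rintro z (rfl | rfl)
        · exact Ideal.subset_span (by simp)
        · exact Ideal.mem_span_pair.mpr ⟨-u * x ^ k, 1, by ring⟩
    · intro hc
      apply hnot
      obtain ⟨k, rfl⟩ : ∃ k, n = k + 1 := ⟨n - 1, by omega⟩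
      have hym : y - u * x ^ (k + 1) ∈ Ideal.span {x, y ^ 1} :=
        Ideal.mem_span_pair.mpr ⟨-u * x ^ k, 1, by ring⟩
      refine (Ideal.span_le.mpr ?_ : Ideal.span {x, (y - u * x ^ (k + 1)) ^ (μ + 1)} ≤ _) hc
      rintro z (rfl | rfl)
      · exact Ideal.subset_span (by simp)
      · simpa using pair_pow hym (μ + 1)
end
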